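/- The infinite series identity $\sum_{k=0}^{\infty}\Big(\frac{-1}{4}\Big)^k\frac{((1)_k)^3(1/2)_k}{((5/4)_k)^2((7/4)_k)^2}(19+56k+40k^2) = 18G$ holds. -/

import Mathlib

open scoped BigOperators

/-- The shifted factorial (Pochhammer symbol) `(x)_n = x (x+1) ⋯ (x+n-1)`. -/
noncomputable def poch (x : ℝ) (n : ℕ) : ℝ := ∏ i ∈ Finset.range n, (x + i)

/-- The harmonic numbers of order 2, `H_n^{(2)} = ∑_{j=1}^n 1/j²`. -/
noncomputable def H2 (n : ℕ) : ℝ := ∑ j ∈ Finset.range n, 1 / ((j : ℝ) + 1) ^ 2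

/-- The Dirichlet beta value `β(4) = ∑_{k≥0} (-1)^k/(1+2k)⁴`. -/
noncomputable def beta4 : ℝ := ∑' k : ℕ, (-1) ^ k / (1 + 2 * (k : ℝ)) ^ 4

/-- The Catalan constant `G = ∑_{k≥0} (-1)^k/(1+2k)²`. -/
noncomputable def catalanG : ℝ := ∑' k : ℕ, (-1) ^ k / (1 + 2 * (k : ℝ)) ^ 2

open Filter Topology

lemma poch_succ (x : ℝ) (n : ℕ) : poch x (n + 1) = poch x n * (x + n) := by
  simp [poch, Finset.prod_range_succ]

lemma poch_pos {x : ℝ} (hx : 0 < x) (n : ℕ) : 0 < poch x n :=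
  Finset.prod_pos fun i _ => by positivity

lemma poch_half_mul (k : ℕ) : poch (1/2) k * (1 + 2 * (k : ℝ)) = poch (3/2) k := by
  induction k with
  | zero => simp [poch]
  | succ k ih =>
    rw [poch_succ, poch_succ, ← ih]
    push_cast
    ring

/-- The first component of a Wilf–Zeilberger pair that at `n = 0` gives the summand of
Catalan's constant. -/
noncomputable def wzF (n k : ℕ) : ℝ :=
  (-1) ^ (n + k) * (Nat.factorial (2 * n) : ℝ) * (Nat.factorial n : ℝ) ^ 2 * poch (1/2) k ^ 2 /
    poch (3/2) (2 * n + k) ^ 2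

/-- The second component of the Wilf–Zeilberger pair. -/
noncomputable def wzG (n k : ℕ) : ℝ :=
  wzF n k * ((k : ℝ) ^ 2 / 2 + (3 * n + 2) * k + 5 * (n : ℝ) ^ 2 + 7 * n + 19 / 8) /
    (2 * (n : ℝ) + k + 3 / 2) ^ 2

lemma wzF_zero_left (k : ℕ) : wzF 0 k = (-1) ^ k / (1 + 2 * (k : ℝ)) ^ 2 := by
  have h := poch_pos (x := 1/2) (by norm_num) k
  simp only [wzF, mul_zero, zero_add, ← poch_half_mul k, Nat.factorial_zero]
  have : (1 + 2 * (k : ℝ)) ≠ 0 := by positivity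
  field_simp
  simp

lemma wzF_succ_left (n k : ℕ) :
    wzF (n + 1) k = -wzF n k * (2 * (2 * (n : ℝ) + 1) * (n + 1) ^ 3) /
      ((2 * (n : ℝ) + k + 3 / 2) ^ 2 * (2 * (n : ℝ) + k + 5 / 2) ^ 2) := by
  have h := (poch_pos (x := 3/2) (by norm_num) (2 * n + k)).ne'
  have e : 2 * (n + 1) + k = 2 * n + k + 1 + 1 := by ring
  have e' : 2 * (n + 1) = 2 * n + 1 + 1 := by ring
  have h1 : (2 * (n : ℝ) + k + 3 / 2) ≠ 0 := by positivity
  have h2 : (2 * (n : ℝ) + k + 5 / 2) ≠ 0 := by positivity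
  have h3 : poch (3/2) (2 * (n + 1) + k) =
      poch (3/2) (2 * n + k) * (2 * (n : ℝ) + k + 3 / 2) * (2 * (n : ℝ) + k + 5 / 2) := by
    rw [e, poch_succ, poch_succ]
    push_cast
    ring
  simp only [wzF, h3]
  rw [e', Nat.factorial_succ, Nat.factorial_succ, Nat.factorial_succ]
  push_cast
  field_simp
  ring

lemma wzF_succ_right (n k : ℕ) :
    wzF n (k + 1) = -wzF n k * ((k : ℝ) + 1 / 2) ^ 2 / (2 * (n : ℝ) + k + 3 / 2) ^ 2 := by
  have h := (poch_pos (x := 3/2) (by norm_num) (2 * n + k)).ne'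
  have h1 : (2 * (n : ℝ) + k + 3 / 2) ≠ 0 := by positivity
  have h3 : poch (3/2) (2 * n + (k + 1)) =
      poch (3/2) (2 * n + k) * (2 * (n : ℝ) + k + 3 / 2) := by
    rw [← add_assoc, poch_succ]
    push_cast
    ring
  simp only [wzF, h3, poch_succ]
  field_simp
  ring

lemma wzF_sub_wzF (n k : ℕ) : wzF n k - wzF (n + 1) k = wzG n k - wzG n (k + 1) := by
  have h1 : (2 * (n : ℝ) + k + 3 / 2) ≠ 0 := by positivity
  have h2 : (2 * (n : ℝ) + k + 5 / 2) ≠ 0 := by positivity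
  have h3 : (2 * (n : ℝ) + (k + 1 : ℕ) + 3 / 2) = 2 * (n : ℝ) + k + 5 / 2 := by
    push_cast
    ring
  simp only [wzG, wzF_succ_left, wzF_succ_right, h3]
  push_cast
  field_simp
  ring

lemma abs_wzF_le (n k : ℕ) : |wzF n k| ≤ (1 / 4) ^ n * (1 / (1 + 2 * (k : ℝ)) ^ 2) := by
  induction n with
  | zero => simp [wzF_zero_left, abs_div]
  | succ n ih =>
    have hr : 2 * (2 * (n : ℝ) + 1) * (n + 1) ^ 3 /
        ((2 * (n : ℝ) + k + 3 / 2) ^ 2 * (2 * (n : ℝ) + k + 5 / 2) ^ 2) ≤ 1 / 4 := by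
      rw [div_le_iff₀ (by positivity)]
      calc 2 * (2 * (n : ℝ) + 1) * (n + 1) ^ 3
          ≤ 1 / 4 * ((2 * (n : ℝ) + 3 / 2) ^ 2 * (2 * (n : ℝ) + 5 / 2) ^ 2) := by
            have hn : (0 : ℝ) ≤ n := n.cast_nonneg
            nlinarith [pow_nonneg hn 2, pow_nonneg hn 3, pow_nonneg hn 4]
        _ ≤ _ := by
            have hk : (0 : ℝ) ≤ k := k.cast_nonneg
            gcongr <;> linarith
    rw [wzF_succ_left, mul_div_assoc, abs_mul, abs_neg, abs_of_nonneg (by positivity : (0 : ℝ) ≤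
      2 * (2 * (n : ℝ) + 1) * (n + 1) ^ 3 /
        ((2 * (n : ℝ) + k + 3 / 2) ^ 2 * (2 * (n : ℝ) + k + 5 / 2) ^ 2))]
    calc _ ≤ (1 / 4) ^ n * (1 / (1 + 2 * (k : ℝ)) ^ 2) * (1 / 4) := by gcongr
      _ = _ := by ring

lemma abs_wzG_le (n k : ℕ) : |wzG n k| ≤ 2 * |wzF n k| := by
  rw [wzG, mul_div_assoc, abs_mul, mul_comm]
  refine mul_le_mul_of_nonneg_right ?_ (abs_nonneg _)
  rw [abs_of_nonneg (by positivity), div_le_iff₀ (by positivity)]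
  have hk : (0 : ℝ) ≤ k := k.cast_nonneg
  have hn : (0 : ℝ) ≤ n := n.cast_nonneg
  nlinarith [mul_nonneg hn hk, mul_nonneg hn hn, mul_nonneg hk hk]

lemma summable_one_div_odd_sq : Summable fun k : ℕ => 1 / (1 + 2 * (k : ℝ)) ^ 2 := by
  have h : Summable fun k : ℕ => 1 / ((k : ℝ) + 1) ^ 2 := by
    have := (summable_nat_add_iff 1).2 (Real.summable_one_div_nat_pow.2 (one_lt_two))
    simpa using this
  refine Summable.of_nonneg_of_le (fun k => by positivity) (fun k => ?_) h
  have hk : (0 : ℝ) ≤ k := k.cast_nonneg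
  apply one_div_le_one_div_of_le (by positivity)
  exact pow_le_pow_left₀ (by positivity) (by linarith) 2

lemma summable_wzF (n : ℕ) : Summable (wzF n) :=
  Summable.of_norm_bounded (summable_one_div_odd_sq.mul_left _) (abs_wzF_le n)

lemma tendsto_wzG (n : ℕ) : Tendsto (wzG n) atTop (𝓝 0) := by
  refine squeeze_zero_norm (abs_wzG_le n) ?_
  simpa using (summable_wzF n).tendsto_atTop_zero.abs.const_mul 2

lemma tsum_wzF_sub (n : ℕ) : ∑' k, wzF n k - ∑' k, wzF (n + 1) k = wzG n 0 := by
  rw [← (summable_wzF n).tsum_sub (summable_wzF (n + 1))]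
  have h := ((summable_wzF n).sub (summable_wzF (n + 1))).hasSum.tendsto_sum_nat
  simp only [wzF_sub_wzF, Finset.sum_range_sub'] at h
  have h' : Tendsto (fun N => wzG n 0 - wzG n N) atTop (𝓝 (wzG n 0)) := by
    simpa using (tendsto_wzG n).const_sub (wzG n 0)
  simpa only [wzF_sub_wzF] using tendsto_nhds_unique h h'

lemma tendsto_tsum_wzF : Tendsto (fun n => ∑' k, wzF n k) atTop (𝓝 0) := by
  refine squeeze_zero_norm
    (a := fun n : ℕ => (1 / 4 : ℝ) ^ n * ∑' k : ℕ, 1 / (1 + 2 * (k : ℝ)) ^ 2) (fun n => ?_) ?_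
  · rw [← tsum_mul_left]
    exact tsum_of_norm_bounded (summable_one_div_odd_sq.mul_left _).hasSum (abs_wzF_le n)
  · simpa only [zero_mul] using (tendsto_pow_atTop_nhds_zero_of_lt_one (r := (1 / 4 : ℝ)) (by norm_num)
      (by norm_num)).mul_const (∑' k : ℕ, 1 / (1 + 2 * (k : ℝ)) ^ 2)

lemma hasSum_wzG_zero : HasSum (fun n => wzG n 0) catalanG := by
  have hs : Summable fun n => wzG n 0 := by
    refine Summable.of_norm_bounded (g := fun n : ℕ => 2 * (1 / 4 : ℝ) ^ n)
      ((summable_geometric_of_lt_one (by norm_num) (by norm_num)).mul_left 2) fun n => ?_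
    have h := abs_wzF_le n 0
    simp only [Nat.cast_zero, mul_zero, add_zero, one_pow, div_one, mul_one] at h
    exact (abs_wzG_le n 0).trans (by linarith)
  have h := hs.hasSum.tendsto_sum_nat
  simp only [← tsum_wzF_sub, Finset.sum_range_sub' (fun n => ∑' k, wzF n k)] at h
  have h' := tendsto_tsum_wzF.const_sub (∑' k, wzF 0 k)
  have e := tendsto_nhds_unique h h'
  simp only [tsum_wzF_sub, sub_zero, wzF_zero_left] at e
  rw [catalanG, ← e]
  exact hs.hasSum

lemma poch_quotient_eq (n : ℕ) :
    (-1/4 : ℝ) ^ n *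
      (poch 1 n ^ 3 * poch (1/2) n / (poch (5/4) n ^ 2 * poch (7/4) n ^ 2)) =
      9 / 4 * wzF n 0 / (2 * (n : ℝ) + 3 / 2) ^ 2 := by
  induction n with
  | zero => norm_num [poch, wzF]
  | succ n ih =>
    have h5 := (poch_pos (x := 5/4) (by norm_num) n).ne'
    have h7 := (poch_pos (x := 7/4) (by norm_num) n).ne'
    have d5 : (5 / 4 + (n : ℝ)) ≠ 0 := by positivity
    have d7 : (7 / 4 + (n : ℝ)) ≠ 0 := by positivity
    have e3 : 2 * (n : ℝ) + 3 / 2 ≠ 0 := by positivity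
    have step : (-1/4 : ℝ) ^ (n + 1) *
        (poch 1 (n + 1) ^ 3 * poch (1/2) (n + 1) /
          (poch (5/4) (n + 1) ^ 2 * poch (7/4) (n + 1) ^ 2)) =
        ((-1/4 : ℝ) ^ n *
          (poch 1 n ^ 3 * poch (1/2) n / (poch (5/4) n ^ 2 * poch (7/4) n ^ 2))) *
        (-1/4 * ((1 + n) ^ 3 * (1 / 2 + n)) / ((5 / 4 + (n : ℝ)) ^ 2 * (7 / 4 + (n : ℝ)) ^ 2)) := by
      simp only [poch_succ, pow_succ (-1/4 : ℝ)]
      field_simp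
    have e5 : 2 * (n : ℝ) + (0 : ℕ) + 5 / 2 = 2 * (5 / 4 + n) := by
      push_cast
      ring
    have e7 : 2 * ((n + 1 : ℕ) : ℝ) + 3 / 2 = 2 * (7 / 4 + n) := by
      push_cast
      ring
    rw [step, ih, wzF_succ_left, e5, e7, Nat.cast_zero, add_zero]
    field_simp
    ring

theorem stmt15 :
    (∑' k : ℕ, (-1/4 : ℝ) ^ k *
      (poch 1 k ^ 3 * poch (1/2) k / (poch (5/4) k ^ 2 * poch (7/4) k ^ 2)) *
      (19 + 56 * (k : ℝ) + 40 * (k : ℝ) ^ 2)) = 18 * catalanG := by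
  rw [← (hasSum_wzG_zero.mul_left 18).tsum_eq]
  refine tsum_congr fun k => ?_
  rw [poch_quotient_eq, wzG, Nat.cast_zero, add_zero]
  ring
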